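/- The closed unit interval I = [0,1] admits no expansive homeomorphism: there is no homeomorphism f : [0,1] → [0,1] together with a constant ε₀ > 0 such that for all distinct x, y ∈ [0,1] there is an integer m with |f^m x − f^m y| ≥ ε₀. -/

import Mathlib

abbrev UI := Set.Icc (0 : ℝ) 1

lemma ui_cont (f : UI ≃ₜ UI) (m : ℤ) : Continuous (fun x => (f.toEquiv ^ m) x) := by
  have hn : ∀ (g : UI ≃ₜ UI) (n : ℕ), Continuous (fun x => (g.toEquiv ^ n) x) := by
    intro g n
    induction n with
    | zero => exact continuous_id
    | succ n ih =>
      simp only [pow_succ, Equiv.Perm.mul_apply]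
      exact ih.comp g.continuous
  cases m with
  | ofNat n => simpa using hn f n
  | negSucc n =>
    have := hn f.symm (n+1)
    have e : f.symm.toEquiv = f.toEquiv⁻¹ := rfl
    rw [e] at this
    simpa only [zpow_negSucc, inv_pow] using this

lemma ui_mono (f : UI ≃ₜ UI) (m : ℤ) :
    StrictMono (fun x => (f.toEquiv ^ m) x) ∨ StrictAnti (fun x => (f.toEquiv ^ m) x) :=
  (ui_cont f m).strictMono_of_inj (f.toEquiv ^ m).injective

lemma ui_even (f : UI ≃ₜ UI) (k : ℤ) : StrictMono (fun x => (f.toEquiv ^ (2 * k)) x) := by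
  rw [two_mul]
  simp only [zpow_add, Equiv.Perm.mul_apply]
  rcases ui_mono f k with h | h
  · exact h.comp h
  · exact h.comp h

lemma mono_diff (a : ℤ → ℝ) (h : Monotone a) (h0 : ∀ k, 0 ≤ a k) (h1 : ∀ k, a k ≤ 1) :
    Filter.Tendsto (fun k => a (k + 1) - a k) Filter.cofinite (nhds 0) := by
  have ht := tendsto_atTop_ciSup h ⟨1, by rintro _ ⟨k, rfl⟩; exact h1 k⟩
  have hb := tendsto_atBot_ciInf h ⟨0, by rintro _ ⟨k, rfl⟩; exact h0 k⟩
  rw [Int.cofinite_eq, Filter.tendsto_sup]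
  constructor
  · simpa using (hb.comp (Filter.tendsto_atBot_add_const_right _ (1 : ℤ) Filter.tendsto_id)).sub hb
  · simpa using (ht.comp (Filter.tendsto_atTop_add_const_right _ (1 : ℤ) Filter.tendsto_id)).sub ht

lemma ui_diff (f : UI ≃ₜ UI) (x : UI) :
    Filter.Tendsto (fun k : ℤ => ((f.toEquiv ^ (2 * (k + 1))) x : ℝ) - ((f.toEquiv ^ (2 * k)) x : ℝ))
      Filter.cofinite (nhds 0) := by
  have e : ∀ k : ℤ, (f.toEquiv ^ (2 * (k + 1))) x
      = (f.toEquiv ^ (2 * k)) ((f.toEquiv ^ (2 : ℤ)) x) := by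
    intro k
    rw [mul_add, zpow_add]; rfl
  rcases le_total x ((f.toEquiv ^ (2 : ℤ)) x) with h | h
  · refine mono_diff (fun k => ((f.toEquiv ^ (2 * k)) x : ℝ)) ?_ (fun k => ((f.toEquiv ^ (2 * k)) x).2.1)
      (fun k => ((f.toEquiv ^ (2 * k)) x).2.2)
    refine monotone_int_of_le_succ fun k => ?_
    rw [e]
    exact (ui_even f k).monotone h
  · have := (mono_diff (fun k => 1 - ((f.toEquiv ^ (2 * k)) x : ℝ)) ?_
      (fun k => sub_nonneg.2 ((f.toEquiv ^ (2 * k)) x).2.2)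
      (fun k => sub_le_self _ ((f.toEquiv ^ (2 * k)) x).2.1)).neg
    · simpa using this
    refine monotone_int_of_le_succ fun k => ?_
    rw [e]
    have h3 : (((f.toEquiv ^ (2 * k)) ((f.toEquiv ^ (2 : ℤ)) x) : UI) : ℝ) ≤ ((f.toEquiv ^ (2 * k)) x : UI) :=
      (ui_even f k).monotone h
    exact sub_le_sub_left h3 1

lemma ui_diff_fin (f : UI ≃ₜ UI) (x : UI) (ε : ℝ) (hε : 0 < ε) :
    {k : ℤ | ε ≤ |((f.toEquiv ^ (2 * (k + 1))) x : ℝ) - ((f.toEquiv ^ (2 * k)) x : ℝ)|}.Finite := by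
  have h := (ui_diff f x).eventually (Metric.ball_mem_nhds 0 hε)
  rw [Filter.eventually_cofinite] at h
  simpa [Real.norm_eq_abs] using h

lemma ui_fin (f : UI ≃ₜ UI) (x : UI) (ε : ℝ) (hε : 0 < ε) :
    {m : ℤ | ε ≤ |((f.toEquiv ^ m) ((f.toEquiv ^ (2 : ℤ)) x) : ℝ) - ((f.toEquiv ^ m) x : ℝ)|}.Finite := by
  refine (((ui_diff_fin f x ε hε).image (fun k => 2 * k)).union
    ((ui_diff_fin f (f x) ε hε).image (fun k => 2 * k + 1))).subset ?_
  intro m hm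
  have e : ∀ (i j : ℤ) (z : UI), (f.toEquiv ^ i) ((f.toEquiv ^ j) z) = (f.toEquiv ^ (i + j)) z := by
    intro i j z; rw [zpow_add]; rfl
  have e1 : ∀ (i : ℤ) (z : UI), (f.toEquiv ^ i) (f z) = (f.toEquiv ^ (i + 1)) z := by
    intro i z; rw [zpow_add, zpow_one]; rfl
  simp only [Set.mem_ofPred_eq, e] at hm
  rcases Int.even_or_odd' m with ⟨k, rfl | rfl⟩
  · left
    refine ⟨k, ?_, rfl⟩
    simpa only [Set.mem_ofPred_eq, mul_add, mul_one] using hm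
  · right
    refine ⟨k, ?_, rfl⟩
    simp only [Set.mem_ofPred_eq, e1]
    convert hm using 6
    ring

/-- Points near `x` stay near `x` under finitely many iterates. -/
lemma ui_near (f : UI ≃ₜ UI) (x : UI) (ε : ℝ) (hε : 0 < ε) (S : Set ℤ) (hS : S.Finite) :
    ∃ δ > 0, ∀ y : UI, |(y : ℝ) - x| < δ →
      ∀ m ∈ S, |((f.toEquiv ^ m) x : ℝ) - ((f.toEquiv ^ m) y : ℝ)| < ε := by
  have h : ∀ᶠ y in nhds x, ∀ m ∈ S,
      |((f.toEquiv ^ m) x : ℝ) - ((f.toEquiv ^ m) y : ℝ)| < ε := by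
    rw [Filter.eventually_all_finite hS]
    intro m _
    have := (ui_cont f m).continuousAt.eventually (Metric.ball_mem_nhds ((f.toEquiv ^ m) x) hε)
    filter_upwards [this] with y hy
    rw [abs_sub_comm]
    exact hy
  obtain ⟨δ, hδ, H⟩ := Metric.eventually_nhds_iff.1 h
  exact ⟨δ, hδ, fun y hy => H hy⟩

lemma ui_pick (x z : UI) (hxz : x ≠ z) (δ : ℝ) (hδ : 0 < δ) :
    ∃ y : UI, y ≠ x ∧ |(y : ℝ) - x| < δ ∧ ((x ≤ y ∧ y ≤ z) ∨ (z ≤ y ∧ y ≤ x)) := by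
  rcases lt_or_gt_of_ne hxz with h | h
  · have h' : (x : ℝ) < z := h
    obtain ⟨y, h1, h2⟩ := exists_between (lt_min h' (lt_add_of_pos_right (x : ℝ) hδ))
    have := lt_min_iff.1 h2
    refine ⟨⟨y, x.2.1.trans h1.le, this.1.le.trans z.2.2⟩, ?_, ?_, Or.inl ⟨h1.le, this.1.le⟩⟩
    · intro hh; exact h1.ne' (congrArg Subtype.val hh)
    · show |y - x| < δ
      rw [abs_lt]; constructor <;> linarith
  · have h' : (z : ℝ) < x := h
    obtain ⟨y, h1, h2⟩ := exists_between (max_lt h' (sub_lt_self (x : ℝ) hδ))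
    have := max_lt_iff.1 h1
    refine ⟨⟨y, z.2.1.trans this.1.le, h2.le.trans x.2.2⟩, ?_, ?_, Or.inr ⟨this.1.le, h2.le⟩⟩
    · intro hh; exact h2.ne (congrArg Subtype.val hh)
    · show |y - x| < δ
      rw [abs_lt]; constructor <;> linarith

lemma abs_between (a b c : ℝ) (h : (a ≤ b ∧ b ≤ c) ∨ (c ≤ b ∧ b ≤ a)) : |a - b| ≤ |c - a| := by
  rcases h with ⟨h1, h2⟩ | ⟨h1, h2⟩
  · rw [abs_of_nonpos (by linarith), abs_of_nonneg (by linarith)]; linarith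
  · rw [abs_of_nonneg (by linarith), abs_of_nonpos (by linarith)]; linarith

/-- The closed unit interval `[0,1]` admits no expansive homeomorphism: there is no
homeomorphism `f : [0,1] → [0,1]` together with a constant `ε₀ > 0` such that for all
distinct `x, y ∈ [0,1]` there is an integer `m` with `|f^m x − f^m y| ≥ ε₀`. -/
theorem no_expansive_homeomorph_of_unitInterval :
    ¬ ∃ (f : (Set.Icc (0 : ℝ) 1) ≃ₜ (Set.Icc (0 : ℝ) 1)) (ε₀ : ℝ), 0 < ε₀ ∧
      ∀ x y : (Set.Icc (0 : ℝ) 1), x ≠ y →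
        ∃ m : ℤ, ε₀ ≤ |(((f.toEquiv ^ m) x : ℝ)) - (((f.toEquiv ^ m) y : ℝ))| := by
  rintro ⟨f, ε, hε, H⟩
  by_cases hid : ∀ x : UI, (f.toEquiv ^ (2 : ℤ)) x = x
  · have h2 : f.toEquiv ^ (2 : ℤ) = 1 := Equiv.ext hid
    obtain ⟨δ, hδ, hn⟩ := ui_near f 0 ε hε {0, 1} (by simp)
    obtain ⟨y, hy, hyd, -⟩ := ui_pick 0 1 (by simp) δ hδ
    obtain ⟨m, hm⟩ := H 0 y hy.symm
    refine absurd hm (not_le.2 ?_)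
    rcases Int.even_or_odd' m with ⟨k, rfl | rfl⟩
    · have := hn y hyd 0 (by simp)
      rw [zpow_mul, h2, one_zpow]
      simpa only [zpow_zero] using this
    · have := hn y hyd 1 (by simp)
      rw [zpow_add, zpow_mul, h2, one_zpow, one_mul]
      exact this
  · push Not at hid
    obtain ⟨x, hx⟩ := hid
    obtain ⟨δ, hδ, hn⟩ := ui_near f x ε hε _ (ui_fin f x ε hε)
    obtain ⟨y, hy, hyd, hb⟩ := ui_pick x _ hx.symm δ hδ
    obtain ⟨m, hm⟩ := H x y hy.symm
    refine absurd hm (not_le.2 (hn y hyd m (hm.trans (abs_between _ _ _ ?_))))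
    rcases ui_mono f m with h | h
    · exact hb.imp (fun q => ⟨h.monotone q.1, h.monotone q.2⟩)
        (fun q => ⟨h.monotone q.1, h.monotone q.2⟩)
    · exact hb.symm.imp (fun q => ⟨h.antitone q.2, h.antitone q.1⟩)
        (fun q => ⟨h.antitone q.2, h.antitone q.1⟩)
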